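/- Fix ρ ∈ (0,∞) and assume (ln n)/d → ρ (so n grows exponentially in d and d(n) → ∞). Then F(n,d,−1,1)^{2/(d−1)} / d → 2π(e^{2ρ} − 1) as n → ∞; that is, the expected number of facets satisfies F(n,d,−1,1) = [2π(e^{2ρ}−1)·d·(1+o(1))]^{(d−1)/2}. -/

import Mathlib

open Filter

noncomputable def c1 (d : ℕ) : ℝ :=
  Real.Gamma ((d : ℝ) / 2) / (Real.sqrt Real.pi * Real.Gamma (((d : ℝ) - 1) / 2))

noncomputable def c2 (d : ℕ) : ℝ :=
  Real.Gamma (((d : ℝ) ^ 2 - 2 * (d : ℝ) + 2) / 2) /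
    (Real.sqrt Real.pi * Real.Gamma (((d : ℝ) ^ 2 - 2 * (d : ℝ) + 1) / 2))

/-- `II n d a b` is the integral `I(n,d,a,b)` from the paper. -/
noncomputable def II (n d : ℕ) (a b : ℝ) : ℝ :=
  ∫ h in a..b, (1 - h ^ 2) ^ (((d : ℝ) ^ 2 - 2 * (d : ℝ) - 1) / 2) *
    (c1 d * ∫ s in (-1 : ℝ)..h, (1 - s ^ 2) ^ (((d : ℝ) - 3) / 2)) ^ (n - d)

/-- `FF n d a b` is the expected number of facets with height in `[a,b]`. -/
noncomputable def FF (n d : ℕ) (a b : ℝ) : ℝ :=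
  (n.choose d : ℝ) * 2 * c2 d * II n d a b

/-- The standard normal CDF. -/
noncomputable def stdPhi (r : ℝ) : ℝ :=
  (Real.sqrt (2 * Real.pi))⁻¹ * ∫ s in Set.Iic r, Real.exp (-s ^ 2 / 2)

open intervalIntegral

/-- The density, up to the factor `c1 d`, of a coordinate of a uniform point on the sphere. -/
noncomputable def capWeight (d : ℕ) (s : ℝ) : ℝ := (1 - s ^ 2) ^ (((d : ℝ) - 3) / 2)

/-- The distribution function of a coordinate of a uniform point on the sphere. -/
noncomputable def capCdf (d : ℕ) (h : ℝ) : ℝ := c1 d * ∫ s in (-1 : ℝ)..h, capWeight d s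

/-- The radial factor whose derivative is `-(d - 1) * s * capWeight d s`. -/
noncomputable def capRadial (d : ℕ) (h : ℝ) : ℝ := (1 - h ^ 2) ^ (((d : ℝ) - 1) / 2)

lemma integral_rpow_mul_one_sub_rpow {a b : ℝ} (ha : 0 < a) (hb : 0 < b) :
    ∫ x in (0 : ℝ)..1, x ^ (a - 1) * (1 - x) ^ (b - 1) =
      Real.Gamma a * Real.Gamma b / Real.Gamma (a + b) := by
  have h := ProbabilityTheory.beta_eq_betaIntegralReal a b ha hb
  rw [ProbabilityTheory.beta] at h
  rw [h, Complex.betaIntegral]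
  have : ∫ x in (0 : ℝ)..1, (x : ℂ) ^ ((a : ℂ) - 1) * (1 - (x : ℂ)) ^ ((b : ℂ) - 1) =
      ∫ x in (0 : ℝ)..1, ((x ^ (a - 1) * (1 - x) ^ (b - 1) : ℝ) : ℂ) := by
    refine integral_congr fun x hx => ?_
    rw [Set.uIcc_of_le zero_le_one] at hx
    rw [Complex.ofReal_mul, Complex.ofReal_cpow hx.1, Complex.ofReal_cpow (by linarith [hx.2])]
    push_cast
    rfl
  rw [this, intervalIntegral.integral_ofReal, Complex.ofReal_re]

lemma integral_one_sub_sq_rpow {p : ℝ} (hp : 0 < p) :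
    ∫ s in (-1 : ℝ)..1, (1 - s ^ 2) ^ (p - 1) =
      Real.sqrt Real.pi * Real.Gamma p / Real.Gamma (p + 1 / 2) := by
  have hsub := mul_integral_comp_mul_sub (a := 0) (b := 1)
    (f := fun s : ℝ => (1 - s ^ 2) ^ (p - 1)) (c := 2) (d := 1)
  norm_num only at hsub
  rw [← hsub]
  have hcongr : ∫ x in (0 : ℝ)..1, (1 - (2 * x - 1) ^ 2) ^ (p - 1) =
      ∫ x in (0 : ℝ)..1, (4 : ℝ) ^ (p - 1) * (x ^ (p - 1) * (1 - x) ^ (p - 1)) := by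
    refine integral_congr fun x hx => ?_
    rw [Set.uIcc_of_le zero_le_one] at hx
    have h1 : 0 ≤ 1 - x := by linarith [hx.2]
    rw [← Real.mul_rpow hx.1 h1, ← Real.mul_rpow (by norm_num) (mul_nonneg hx.1 h1)]
    congr 1
    ring
  rw [hcongr, integral_const_mul, integral_rpow_mul_one_sub_rpow hp hp]
  have hdup := Real.Gamma_mul_Gamma_add_half p
  have g1 := Real.Gamma_pos_of_pos hp
  have g2 := Real.Gamma_pos_of_pos (show 0 < p + 1 / 2 by linarith)
  have g3 := Real.Gamma_pos_of_pos (show 0 < p + p by linarith)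
  rw [← two_mul] at g3 ⊢
  have h4 : (2 : ℝ) * 4 ^ (p - 1) * 2 ^ (1 - 2 * p) = 1 := by
    rw [show (4 : ℝ) = 2 ^ (2 : ℝ) by norm_num, ← Real.rpow_mul (by norm_num)]
    nth_rewrite 1 [← Real.rpow_one 2]
    rw [← Real.rpow_add (by norm_num), ← Real.rpow_add (by norm_num)]
    ring_nf
    simp
  rw [eq_div_iff g2.ne']
  calc _ = 2 * 4 ^ (p - 1) * Real.Gamma p * (Real.Gamma p * Real.Gamma (p + 1 / 2)) /
        Real.Gamma (2 * p) := by ring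
    _ = (2 * 4 ^ (p - 1) * 2 ^ (1 - 2 * p)) * Real.sqrt Real.pi * Real.Gamma p := by
        rw [hdup]; field_simp
    _ = _ := by rw [h4, one_mul]

lemma c1_pos {d : ℕ} (hd : 3 ≤ d) : 0 < c1 d := by
  have h3 : (3 : ℝ) ≤ d := by exact_mod_cast hd
  have g1 := Real.Gamma_pos_of_pos (show 0 < (d : ℝ) / 2 by linarith)
  have g2 := Real.Gamma_pos_of_pos (show 0 < ((d : ℝ) - 1) / 2 by linarith)
  have := Real.sqrt_pos.2 Real.pi_pos
  unfold c1
  positivity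

lemma capCdf_one {d : ℕ} (hd : 3 ≤ d) : capCdf d 1 = 1 := by
  have h3 : (3 : ℝ) ≤ d := by exact_mod_cast hd
  have h := integral_one_sub_sq_rpow (show 0 < ((d : ℝ) - 1) / 2 by linarith)
  rw [show ((d : ℝ) - 1) / 2 - 1 = ((d : ℝ) - 3) / 2 by ring,
    show ((d : ℝ) - 1) / 2 + 1 / 2 = (d : ℝ) / 2 by ring] at h
  unfold capCdf capWeight
  rw [h, c1]
  have g1 := Real.Gamma_pos_of_pos (show 0 < (d : ℝ) / 2 by linarith)
  have g2 := Real.Gamma_pos_of_pos (show 0 < ((d : ℝ) - 1) / 2 by linarith)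
  have := Real.sqrt_pos.2 Real.pi_pos
  field_simp

lemma capCdf_neg_one (d : ℕ) : capCdf d (-1) = 0 := by simp [capCdf]

lemma continuous_capWeight {d : ℕ} (hd : 3 ≤ d) : Continuous (capWeight d) := by
  have h3 : (3 : ℝ) ≤ d := by exact_mod_cast hd
  unfold capWeight
  exact (by fun_prop : Continuous fun s : ℝ => 1 - s ^ 2).rpow_const
    fun _ => Or.inr (by linarith)

lemma continuous_capRadial {d : ℕ} (hd : 3 ≤ d) : Continuous (capRadial d) := by
  have h3 : (3 : ℝ) ≤ d := by exact_mod_cast hd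
  unfold capRadial
  exact (by fun_prop : Continuous fun s : ℝ => 1 - s ^ 2).rpow_const
    fun _ => Or.inr (by linarith)

lemma hasDerivAt_capCdf {d : ℕ} (hd : 3 ≤ d) (h : ℝ) :
    HasDerivAt (capCdf d) (c1 d * capWeight d h) h :=
  (integral_hasDerivAt_right ((continuous_capWeight hd).intervalIntegrable _ _)
    ((continuous_capWeight hd).stronglyMeasurableAtFilter _ _)
    (continuous_capWeight hd).continuousAt).const_mul _

lemma continuous_capCdf {d : ℕ} (hd : 3 ≤ d) : Continuous (capCdf d) :=
  continuous_iff_continuousAt.2 fun h => (hasDerivAt_capCdf hd h).continuousAt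

lemma capWeight_nonneg (d : ℕ) {s : ℝ} (hs : s ∈ Set.Icc (-1 : ℝ) 1) : 0 ≤ capWeight d s :=
  Real.rpow_nonneg (by nlinarith [hs.1, hs.2]) _

lemma capRadial_nonneg (d : ℕ) {s : ℝ} (hs : s ∈ Set.Icc (-1 : ℝ) 1) : 0 ≤ capRadial d s :=
  Real.rpow_nonneg (by nlinarith [hs.1, hs.2]) _

lemma capCdf_sub {d : ℕ} (hd : 3 ≤ d) (a b : ℝ) :
    capCdf d b - capCdf d a = c1 d * ∫ s in a..b, capWeight d s := by
  unfold capCdf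
  rw [← mul_sub, integral_interval_sub_left] <;>
    exact (continuous_capWeight hd).intervalIntegrable _ _

lemma capCdf_mono {d : ℕ} (hd : 3 ≤ d) {a b : ℝ} (ha : -1 ≤ a) (hab : a ≤ b) (hb : b ≤ 1) :
    capCdf d a ≤ capCdf d b := by
  rw [← sub_nonneg, capCdf_sub hd]
  exact mul_nonneg (c1_pos hd).le (integral_nonneg hab fun s hs =>
    capWeight_nonneg d ⟨ha.trans hs.1, hs.2.trans hb⟩)

lemma capCdf_nonneg {d : ℕ} (hd : 3 ≤ d) {h : ℝ} (hh : h ∈ Set.Icc (-1 : ℝ) 1) :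
    0 ≤ capCdf d h :=
  capCdf_neg_one d ▸ capCdf_mono hd le_rfl hh.1 hh.2

lemma capCdf_le_one {d : ℕ} (hd : 3 ≤ d) {h : ℝ} (hh : h ∈ Set.Icc (-1 : ℝ) 1) :
    capCdf d h ≤ 1 :=
  capCdf_one hd ▸ capCdf_mono hd hh.1 hh.2 le_rfl

lemma integral_mul_capWeight {d : ℕ} (hd : 3 ≤ d) (a b : ℝ) :
    ∫ s in a..b, s * capWeight d s = (capRadial d a - capRadial d b) / ((d : ℝ) - 1) := by
  have h3 : (3 : ℝ) ≤ d := by exact_mod_cast hd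
  have hder : ∀ s : ℝ, HasDerivAt (fun s => -(capRadial d s / ((d : ℝ) - 1)))
      (s * capWeight d s) s := by
    intro s
    have h1 : HasDerivAt (fun s : ℝ => 1 - s ^ 2) (-(2 * s)) s := by
      simpa using ((hasDerivAt_pow 2 s).const_sub 1)
    have h2 := ((h1.rpow_const (p := ((d : ℝ) - 1) / 2) (Or.inr (by linarith))).div_const
      ((d : ℝ) - 1)).neg
    refine h2.congr_deriv ?_
    rw [capWeight, show ((d : ℝ) - 1) / 2 - 1 = ((d : ℝ) - 3) / 2 by ring]
    have : (d : ℝ) - 1 ≠ 0 := by linarith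
    field_simp
  rw [integral_eq_sub_of_hasDerivAt (fun s _ => hder s)
    ((continuous_id.mul (continuous_capWeight hd)).intervalIntegrable _ _)]
  ring

lemma capRadial_one {d : ℕ} (hd : 3 ≤ d) : capRadial d 1 = 0 := by
  have h3 : (3 : ℝ) ≤ d := by exact_mod_cast hd
  unfold capRadial
  rw [one_pow, sub_self, Real.zero_rpow (by linarith)]

/-- The scale `(d - 1) / c1 d` relating `capRadial d` to the tail `1 - capCdf d`. -/
noncomputable def capScale (d : ℕ) : ℝ := ((d : ℝ) - 1) / c1 d

lemma capScale_pos {d : ℕ} (hd : 3 ≤ d) : 0 < capScale d := by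
  have h3 : (3 : ℝ) ≤ d := by exact_mod_cast hd
  exact div_pos (by linarith) (c1_pos hd)

lemma capScale_mul_capCdf_sub {d : ℕ} (hd : 3 ≤ d) (a b : ℝ) :
    capScale d * (capCdf d b - capCdf d a) = ((d : ℝ) - 1) * ∫ s in a..b, capWeight d s := by
  have := (c1_pos hd).ne'
  rw [capCdf_sub hd, capScale]
  field_simp

lemma capRadial_sub_le {d : ℕ} (hd : 3 ≤ d) {a b : ℝ} (ha : -1 ≤ a) (hab : a ≤ b) (hb : b ≤ 1) :
    capRadial d a - capRadial d b ≤ b * (capScale d * (capCdf d b - capCdf d a)) := by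
  have h3 : (3 : ℝ) ≤ d := by exact_mod_cast hd
  have hle : ∫ s in a..b, s * capWeight d s ≤ ∫ s in a..b, b * capWeight d s :=
    integral_mono_on hab ((continuous_id.mul (continuous_capWeight hd)).intervalIntegrable _ _)
      ((continuous_const.mul (continuous_capWeight hd)).intervalIntegrable _ _) fun s hs =>
      mul_le_mul_of_nonneg_right hs.2 (capWeight_nonneg d ⟨ha.trans hs.1, hs.2.trans hb⟩)
  rw [integral_mul_capWeight hd, integral_const_mul, div_le_iff₀ (by linarith)] at hle
  rw [capScale_mul_capCdf_sub hd]
  linarith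

lemma le_capRadial_sub {d : ℕ} (hd : 3 ≤ d) {a b : ℝ} (ha : -1 ≤ a) (hab : a ≤ b) (hb : b ≤ 1) :
    a * (capScale d * (capCdf d b - capCdf d a)) ≤ capRadial d a - capRadial d b := by
  have h3 : (3 : ℝ) ≤ d := by exact_mod_cast hd
  have hle : ∫ s in a..b, a * capWeight d s ≤ ∫ s in a..b, s * capWeight d s :=
    integral_mono_on hab ((continuous_const.mul (continuous_capWeight hd)).intervalIntegrable _ _)
      ((continuous_id.mul (continuous_capWeight hd)).intervalIntegrable _ _) fun s hs =>
      mul_le_mul_of_nonneg_right hs.1 (capWeight_nonneg d ⟨ha.trans hs.1, hs.2.trans hb⟩)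
  rw [integral_mul_capWeight hd, integral_const_mul, le_div_iff₀ (by linarith)] at hle
  rw [capScale_mul_capCdf_sub hd]
  linarith

lemma mul_tail_le_capRadial {d : ℕ} (hd : 3 ≤ d) {h : ℝ} (hh : h ∈ Set.Icc (-1 : ℝ) 1) :
    h * (capScale d * (1 - capCdf d h)) ≤ capRadial d h := by
  simpa [capCdf_one hd, capRadial_one hd] using le_capRadial_sub hd hh.1 hh.2 le_rfl

lemma capRadial_le_tail {d : ℕ} (hd : 3 ≤ d) {h : ℝ} (hh : h ∈ Set.Icc (-1 : ℝ) 1) :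
    capRadial d h ≤ capScale d * (1 - capCdf d h) := by
  simpa [capCdf_one hd, capRadial_one hd] using capRadial_sub_le hd hh.1 hh.2 le_rfl

/-- Up to a factor exponentially close to one, `capRadial d h` is at most `h + ε` times the
rescaled tail. -/
lemma capRadial_mul_le_tail {d : ℕ} (hd : 3 ≤ d) {h ε : ℝ} (hh : 0 ≤ h) (hε : 0 ≤ ε)
    (hhε : h + ε ≤ 1) :
    capRadial d h * (1 - (1 - ε ^ 2) ^ (((d : ℝ) - 1) / 2)) ≤
      (h + ε) * (capScale d * (1 - capCdf d h)) := by
  have h3 : (3 : ℝ) ≤ d := by exact_mod_cast hd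
  have h1 := capRadial_sub_le hd (show -1 ≤ h by linarith) (show h ≤ h + ε by linarith) hhε
  have h2 : capRadial d (h + ε) ≤ capRadial d h * (1 - ε ^ 2) ^ (((d : ℝ) - 1) / 2) := by
    unfold capRadial
    rw [← Real.mul_rpow (by nlinarith) (by nlinarith)]
    refine Real.rpow_le_rpow (by nlinarith) ?_ (by linarith)
    nlinarith [mul_nonneg hh hε, sq_nonneg (h * ε)]
  have h4 := capCdf_le_one hd (show h + ε ∈ Set.Icc (-1 : ℝ) 1 from ⟨by linarith, hhε⟩)
  have h5 : (h + ε) * (capScale d * (capCdf d (h + ε) - capCdf d h)) ≤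
      (h + ε) * (capScale d * (1 - capCdf d h)) := by
    have := (capScale_pos hd).le
    gcongr
  linarith

lemma integral_comp_capCdf {d : ℕ} (hd : 3 ≤ d) (g : ℝ → ℝ) (hg : Continuous g) (a b : ℝ) :
    ∫ h in a..b, g (capCdf d h) * (c1 d * capWeight d h) = ∫ u in capCdf d a..capCdf d b, g u :=
  integral_comp_mul_deriv (fun h _ => hasDerivAt_capCdf hd h)
    ((continuous_const.mul (continuous_capWeight hd)).continuousOn) hg

lemma integral_capDensity {d : ℕ} (hd : 3 ≤ d) (a b : ℝ) :
    ∫ h in a..b, c1 d * capWeight d h = capCdf d b - capCdf d a := by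
  rw [integral_const_mul, capCdf_sub hd]

lemma choose_mul_integral_tail {n d : ℕ} (hd : 3 ≤ d) (hn : d < n) :
    (n.choose d : ℝ) * ∫ h in (-1 : ℝ)..1,
      ((1 - capCdf d h) ^ (d - 2) * capCdf d h ^ (n - d)) * (c1 d * capWeight d h) =
      n / (d * ((d : ℝ) - 1)) := by
  rw [integral_comp_capCdf hd (fun u => (1 - u) ^ (d - 2) * u ^ (n - d)) (by fun_prop),
    capCdf_one hd, capCdf_neg_one]
  obtain ⟨k, rfl⟩ := Nat.exists_eq_add_of_lt hn
  obtain ⟨e, rfl⟩ := Nat.exists_eq_add_of_le' hd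
  have h := integral_rpow_mul_one_sub_rpow (show (0 : ℝ) < (k + 2 : ℕ) by positivity)
    (show (0 : ℝ) < (e + 2 : ℕ) by positivity)
  have hc : ∫ x in (0 : ℝ)..1, x ^ (((k + 2 : ℕ) : ℝ) - 1) * (1 - x) ^ (((e + 2 : ℕ) : ℝ) - 1) =
      ∫ u in (0 : ℝ)..1, (1 - u) ^ (e + 3 - 2) * u ^ (e + 3 + k + 1 - (e + 3)) := by
    refine integral_congr fun x _ => ?_
    rw [show ((k + 2 : ℕ) : ℝ) - 1 = (k + 1 : ℕ) by push_cast; ring,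
      show ((e + 2 : ℕ) : ℝ) - 1 = (e + 1 : ℕ) by push_cast; ring,
      Real.rpow_natCast, Real.rpow_natCast, mul_comm]
    congr 2
    omega
  rw [← hc, h, Nat.cast_choose ℝ hn.le, show e + 3 + k + 1 - (e + 3) = k + 1 by omega,
    show ((k + 2 : ℕ) : ℝ) = (k + 1 : ℕ) + 1 by push_cast; ring,
    show ((e + 2 : ℕ) : ℝ) = (e + 1 : ℕ) + 1 by push_cast; ring,
    show ((k + 1 : ℕ) : ℝ) + 1 + ((e + 1 : ℕ) + 1) = (k + e + 3 : ℕ) + 1 by push_cast; ring,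
    Real.Gamma_nat_eq_factorial, Real.Gamma_nat_eq_factorial, Real.Gamma_nat_eq_factorial,
    show e + 3 + k + 1 = (k + e + 3) + 1 by ring, Nat.factorial_succ (k + e + 3),
    show e + 3 = (e + 1) + 1 + 1 by ring, Nat.factorial_succ (e + 1 + 1),
    Nat.factorial_succ (e + 1)]
  have f1 : ((k + 1).factorial : ℝ) ≠ 0 := by positivity
  have f2 : ((e + 1).factorial : ℝ) ≠ 0 := by positivity
  have f3 : ((k + e + 3).factorial : ℝ) ≠ 0 := by positivity
  rw [show ((e + 1 + 1 + 1 : ℕ) : ℝ) - 1 = e + 2 by push_cast; ring]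
  push_cast
  field_simp
  ring

lemma II_eq {n d : ℕ} (hd : 3 ≤ d) :
    II n d (-1) 1 = (c1 d)⁻¹ * ∫ h in (-1 : ℝ)..1,
      (capRadial d h ^ (d - 2) * capCdf d h ^ (n - d)) * (c1 d * capWeight d h) := by
  have h3 : (3 : ℝ) ≤ d := by exact_mod_cast hd
  have hc := (c1_pos hd).ne'
  rw [← integral_const_mul, II]
  refine integral_congr fun h hh => ?_
  rw [Set.uIcc_of_le (by norm_num)] at hh
  have hnn : 0 ≤ 1 - h ^ 2 := by nlinarith [hh.1, hh.2]
  have hpow : (1 - h ^ 2) ^ (((d : ℝ) ^ 2 - 2 * (d : ℝ) - 1) / 2) =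
      capWeight d h * capRadial d h ^ (d - 2) := by
    rw [capWeight, capRadial, ← Real.rpow_natCast _ (d - 2), ← Real.rpow_mul hnn,
      ← Real.rpow_add_of_nonneg hnn (by linarith) (mul_nonneg (by linarith) (Nat.cast_nonneg _)), Nat.cast_sub (by omega)]
    congr 1
    push_cast
    ring
  rw [hpow]
  change _ * capCdf d h ^ (n - d) = _
  field_simp

lemma capRadial_le_one (d : ℕ) (hd : 3 ≤ d) {h : ℝ} (hh : h ∈ Set.Icc (-1 : ℝ) 1) :
    capRadial d h ≤ 1 := by
  have h3 : (3 : ℝ) ≤ d := by exact_mod_cast hd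
  exact Real.rpow_le_one (by nlinarith [hh.1, hh.2]) (by nlinarith) (by linarith)

lemma capRadial_anti {d : ℕ} (hd : 3 ≤ d) {a b : ℝ} (ha : 0 ≤ a) (hab : a ≤ b) (hb : b ≤ 1) :
    capRadial d b ≤ capRadial d a := by
  have h3 : (3 : ℝ) ≤ d := by exact_mod_cast hd
  exact Real.rpow_le_rpow (by nlinarith) (by nlinarith) (by linarith)

lemma integral_capRadial_le {d : ℕ} (hd : 3 ≤ d) (N : ℕ) {a b κ : ℝ} (ha : 0 ≤ a)
    (hab : a ≤ b) (hb : b ≤ 1) (hκ : 0 ≤ κ)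
    (hle : ∀ h ∈ Set.Icc a b, capRadial d h ≤ κ * (1 - capCdf d h)) :
    ∫ h in (-1 : ℝ)..1, (capRadial d h ^ (d - 2) * capCdf d h ^ N) * (c1 d * capWeight d h) ≤
      capCdf d a ^ N + κ ^ (d - 2) * (∫ h in (-1 : ℝ)..1,
        ((1 - capCdf d h) ^ (d - 2) * capCdf d h ^ N) * (c1 d * capWeight d h)) +
      capRadial d b ^ (d - 2) := by
  have cU := continuous_capRadial hd
  have cG := continuous_capCdf hd
  have cw := continuous_capWeight hd
  have hc := (c1_pos hd).le
  have cP : Continuous fun h => (capRadial d h ^ (d - 2) * capCdf d h ^ N) *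
    (c1 d * capWeight d h) := by fun_prop
  have cQ : Continuous fun h => ((1 - capCdf d h) ^ (d - 2) * capCdf d h ^ N) *
    (c1 d * capWeight d h) := by fun_prop
  have cD : Continuous fun h => c1 d * capWeight d h := by fun_prop
  rw [← integral_add_adjacent_intervals (cP.intervalIntegrable (-1) a)
    (cP.intervalIntegrable a 1), ← integral_add_adjacent_intervals (cP.intervalIntegrable a b)
    (cP.intervalIntegrable b 1), ← add_assoc]
  refine add_le_add (add_le_add ?_ ?_) ?_
  · have ha1 : a ∈ Set.Icc (-1 : ℝ) 1 := ⟨by linarith, by linarith⟩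
    calc _ ≤ ∫ h in (-1 : ℝ)..a, capCdf d a ^ N * (c1 d * capWeight d h) := by
          refine integral_mono_on ha1.1 (cP.intervalIntegrable _ _)
            ((continuous_const.mul cD).intervalIntegrable _ _) fun h hh => ?_
          have hh1 : h ∈ Set.Icc (-1 : ℝ) 1 := ⟨hh.1, hh.2.trans ha1.2⟩
          refine mul_le_mul_of_nonneg_right ?_ (mul_nonneg hc (capWeight_nonneg d hh1))
          calc _ ≤ 1 * capCdf d h ^ N := mul_le_mul_of_nonneg_right
                (pow_le_one₀ (capRadial_nonneg d hh1) (capRadial_le_one d hd hh1))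
                (pow_nonneg (capCdf_nonneg hd hh1) _)
            _ ≤ _ := by
                rw [one_mul]
                exact pow_le_pow_left₀ (capCdf_nonneg hd hh1)
                  (capCdf_mono hd hh.1 hh.2 ha1.2) _
      _ = capCdf d a ^ N * capCdf d a := by
          rw [integral_const_mul, integral_capDensity hd, capCdf_neg_one, sub_zero]
      _ ≤ _ := mul_le_of_le_one_right (pow_nonneg (capCdf_nonneg hd ha1) _)
          (capCdf_le_one hd ha1)
  · calc _ ≤ ∫ h in a..b, κ ^ (d - 2) * (((1 - capCdf d h) ^ (d - 2) * capCdf d h ^ N) *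
            (c1 d * capWeight d h)) := by
          refine integral_mono_on hab (cP.intervalIntegrable _ _)
            ((continuous_const.mul cQ).intervalIntegrable _ _) fun h hh => ?_
          have hh1 : h ∈ Set.Icc (-1 : ℝ) 1 := ⟨by linarith [hh.1], hh.2.trans hb⟩
          rw [← mul_assoc (κ ^ (d - 2)), ← mul_assoc (κ ^ (d - 2)), ← mul_pow]
          refine mul_le_mul_of_nonneg_right (mul_le_mul_of_nonneg_right
            (pow_le_pow_left₀ (capRadial_nonneg d hh1) (hle h hh) _)
            (pow_nonneg (capCdf_nonneg hd hh1) _)) (mul_nonneg hc (capWeight_nonneg d hh1))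
      _ = κ ^ (d - 2) * ∫ h in a..b, ((1 - capCdf d h) ^ (d - 2) * capCdf d h ^ N) *
            (c1 d * capWeight d h) := integral_const_mul _ _
      _ ≤ _ := by
          refine mul_le_mul_of_nonneg_left ?_ (pow_nonneg hκ _)
          refine integral_mono_interval (by linarith) hab hb ?_ (cQ.intervalIntegrable _ _)
          refine (MeasureTheory.ae_restrict_mem measurableSet_Ioc).mono fun h hh => ?_
          have hh1 : h ∈ Set.Icc (-1 : ℝ) 1 := ⟨hh.1.le, hh.2⟩
          exact mul_nonneg (mul_nonneg (pow_nonneg (by linarith [capCdf_le_one hd hh1]) _)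
            (pow_nonneg (capCdf_nonneg hd hh1) _)) (mul_nonneg hc (capWeight_nonneg d hh1))
  · have hb1 : b ∈ Set.Icc (-1 : ℝ) 1 := ⟨by linarith, hb⟩
    calc _ ≤ ∫ h in b..1, capRadial d b ^ (d - 2) * (c1 d * capWeight d h) := by
          refine integral_mono_on hb (cP.intervalIntegrable _ _)
            ((continuous_const.mul cD).intervalIntegrable _ _) fun h hh => ?_
          have hh1 : h ∈ Set.Icc (-1 : ℝ) 1 := ⟨by linarith [hh.1], hh.2⟩
          refine mul_le_mul_of_nonneg_right ?_ (mul_nonneg hc (capWeight_nonneg d hh1))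
          calc _ ≤ capRadial d h ^ (d - 2) * 1 := mul_le_mul_of_nonneg_left
                (pow_le_one₀ (capCdf_nonneg hd hh1) (capCdf_le_one hd hh1))
                (pow_nonneg (capRadial_nonneg d hh1) _)
            _ ≤ _ := by
                rw [mul_one]
                exact pow_le_pow_left₀ (capRadial_nonneg d hh1)
                  (capRadial_anti hd (ha.trans hab) hh.1 hh.2) _
      _ = capRadial d b ^ (d - 2) * (1 - capCdf d b) := by
          rw [integral_const_mul, integral_capDensity hd, capCdf_one hd]
      _ ≤ _ := mul_le_of_le_one_right (pow_nonneg (capRadial_nonneg d hb1) _)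
          (by linarith [capCdf_nonneg hd hb1])

lemma le_integral_capRadial {d : ℕ} (hd : 3 ≤ d) (N : ℕ) {a : ℝ} (ha : 0 ≤ a) (ha1 : a ≤ 1) :
    (a * capScale d) ^ (d - 2) * ((∫ h in (-1 : ℝ)..1,
        ((1 - capCdf d h) ^ (d - 2) * capCdf d h ^ N) * (c1 d * capWeight d h)) -
        capCdf d a ^ N) ≤
      ∫ h in (-1 : ℝ)..1, (capRadial d h ^ (d - 2) * capCdf d h ^ N) *
        (c1 d * capWeight d h) := by
  have cU := continuous_capRadial hd
  have cG := continuous_capCdf hd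
  have cw := continuous_capWeight hd
  have hc := (c1_pos hd).le
  have hA := (capScale_pos hd).le
  have cP : Continuous fun h => (capRadial d h ^ (d - 2) * capCdf d h ^ N) *
    (c1 d * capWeight d h) := by fun_prop
  have cQ : Continuous fun h => ((1 - capCdf d h) ^ (d - 2) * capCdf d h ^ N) *
    (c1 d * capWeight d h) := by fun_prop
  have cD : Continuous fun h => c1 d * capWeight d h := by fun_prop
  have haI : a ∈ Set.Icc (-1 : ℝ) 1 := ⟨by linarith, ha1⟩
  have h1 : ∫ h in (-1 : ℝ)..a, ((1 - capCdf d h) ^ (d - 2) * capCdf d h ^ N) *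
      (c1 d * capWeight d h) ≤ capCdf d a ^ N :=
    calc _ ≤ ∫ h in (-1 : ℝ)..a, capCdf d a ^ N * (c1 d * capWeight d h) := by
          refine integral_mono_on haI.1 (cQ.intervalIntegrable _ _)
            ((continuous_const.mul cD).intervalIntegrable _ _) fun h hh => ?_
          have hh1 : h ∈ Set.Icc (-1 : ℝ) 1 := ⟨hh.1, hh.2.trans ha1⟩
          refine mul_le_mul_of_nonneg_right ?_ (mul_nonneg hc (capWeight_nonneg d hh1))
          calc _ ≤ 1 * capCdf d h ^ N := mul_le_mul_of_nonneg_right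
                (pow_le_one₀ (by linarith [capCdf_le_one hd hh1])
                  (by linarith [capCdf_nonneg hd hh1]))
                (pow_nonneg (capCdf_nonneg hd hh1) _)
            _ ≤ _ := by
                rw [one_mul]
                exact pow_le_pow_left₀ (capCdf_nonneg hd hh1)
                  (capCdf_mono hd hh.1 hh.2 ha1) _
      _ = capCdf d a ^ N * capCdf d a := by
          rw [integral_const_mul, integral_capDensity hd, capCdf_neg_one, sub_zero]
      _ ≤ _ := mul_le_of_le_one_right (pow_nonneg (capCdf_nonneg hd haI) _)
          (capCdf_le_one hd haI)
  have h2 := integral_add_adjacent_intervals (cQ.intervalIntegrable (-1) a)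
    (cQ.intervalIntegrable (μ := MeasureTheory.volume) a 1)
  calc _ ≤ (a * capScale d) ^ (d - 2) * ∫ h in a..1,
        ((1 - capCdf d h) ^ (d - 2) * capCdf d h ^ N) * (c1 d * capWeight d h) := by
        refine mul_le_mul_of_nonneg_left ?_ (by positivity)
        linarith
    _ = ∫ h in a..1, (a * capScale d) ^ (d - 2) *
        (((1 - capCdf d h) ^ (d - 2) * capCdf d h ^ N) * (c1 d * capWeight d h)) :=
        (integral_const_mul _ _).symm
    _ ≤ ∫ h in a..1, (capRadial d h ^ (d - 2) * capCdf d h ^ N) * (c1 d * capWeight d h) := by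
        refine integral_mono_on ha1 ((continuous_const.mul cQ).intervalIntegrable _ _)
          (cP.intervalIntegrable _ _) fun h hh => ?_
        have hh1 : h ∈ Set.Icc (-1 : ℝ) 1 := ⟨by linarith [hh.1], hh.2⟩
        have hT : 0 ≤ 1 - capCdf d h := by linarith [capCdf_le_one hd hh1]
        rw [← mul_assoc ((a * capScale d) ^ (d - 2)),
          ← mul_assoc ((a * capScale d) ^ (d - 2)), ← mul_pow]
        refine mul_le_mul_of_nonneg_right (mul_le_mul_of_nonneg_right
          (pow_le_pow_left₀ (by positivity) ?_ _)
          (pow_nonneg (capCdf_nonneg hd hh1) _)) (mul_nonneg hc (capWeight_nonneg d hh1))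
        refine le_trans ?_ (mul_tail_le_capRadial hd hh1)
        rw [mul_assoc]
        exact mul_le_mul_of_nonneg_right hh.1 (by positivity)
    _ ≤ _ := by
        refine integral_mono_interval haI.1 ha1 le_rfl ?_ (cP.intervalIntegrable _ _)
        refine (MeasureTheory.ae_restrict_mem measurableSet_Ioc).mono fun h hh => ?_
        have hh1 : h ∈ Set.Icc (-1 : ℝ) 1 := ⟨hh.1.le, hh.2⟩
        exact mul_nonneg (mul_nonneg (pow_nonneg (capRadial_nonneg d hh1) _)
          (pow_nonneg (capCdf_nonneg hd hh1) _)) (mul_nonneg hc (capWeight_nonneg d hh1))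

lemma Gamma_add_half_sq_le {x : ℝ} (hx : 0 < x) :
    Real.Gamma (x + 1 / 2) ^ 2 ≤ x * Real.Gamma x ^ 2 := by
  have h := Real.Gamma_mul_add_mul_le_rpow_Gamma_mul_rpow_Gamma hx (show 0 < x + 1 by linarith)
    (show (0 : ℝ) < 1 / 2 by norm_num) (show (0 : ℝ) < 1 / 2 by norm_num) (by norm_num)
  rw [show 1 / 2 * x + 1 / 2 * (x + 1) = x + 1 / 2 by ring, ← Real.sqrt_eq_rpow,
    ← Real.sqrt_eq_rpow, Real.Gamma_add_one hx.ne'] at h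
  have g := Real.Gamma_pos_of_pos hx
  have g' := Real.Gamma_pos_of_pos (show 0 < x + 1 / 2 by linarith)
  calc _ ≤ (Real.sqrt (Real.Gamma x) * Real.sqrt (x * Real.Gamma x)) ^ 2 :=
        pow_le_pow_left₀ g'.le h 2
    _ = _ := by
        rw [mul_pow, Real.sq_sqrt g.le, Real.sq_sqrt (by positivity)]
        ring

lemma le_Gamma_add_half_sq {x : ℝ} (hx : 1 / 2 < x) :
    (x - 1 / 2) * Real.Gamma x ^ 2 ≤ Real.Gamma (x + 1 / 2) ^ 2 := by
  have h := Gamma_add_half_sq_le (show 0 < x - 1 / 2 by linarith)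
  have e := Real.Gamma_add_one (show x - 1 / 2 ≠ 0 by linarith)
  rw [show x - 1 / 2 + 1 / 2 = x by ring] at h
  rw [show x - 1 / 2 + 1 = x + 1 / 2 by ring] at e
  rw [e, mul_pow, sq (x - 1 / 2), mul_assoc]
  exact mul_le_mul_of_nonneg_left h (by linarith)

lemma Gamma_quotient_sq_mem {x : ℝ} (hx : 1 / 2 < x) :
    (Real.Gamma (x + 1 / 2) / (Real.sqrt Real.pi * Real.Gamma x)) ^ 2 ∈
      Set.Icc ((x - 1 / 2) / Real.pi) (x / Real.pi) := by
  have g := Real.Gamma_pos_of_pos (show 0 < x by linarith)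
  have hpi := Real.pi_pos
  rw [div_pow, mul_pow, Real.sq_sqrt hpi.le]
  constructor
  · rw [div_le_div_iff₀ hpi (by positivity)]
    nlinarith [le_Gamma_add_half_sq hx]
  · rw [div_le_div_iff₀ (by positivity) hpi]
    nlinarith [Gamma_add_half_sq_le (show 0 < x by linarith)]

lemma c1_sq_mem {d : ℕ} (hd : 3 ≤ d) :
    c1 d ^ 2 ∈ Set.Icc (((d : ℝ) - 2) / (2 * Real.pi)) (((d : ℝ) - 1) / (2 * Real.pi)) := by
  have h3 : (3 : ℝ) ≤ d := by exact_mod_cast hd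
  have h := Gamma_quotient_sq_mem (show 1 / 2 < ((d : ℝ) - 1) / 2 by linarith)
  rw [show ((d : ℝ) - 1) / 2 + 1 / 2 = (d : ℝ) / 2 by ring] at h
  rw [show (((d : ℝ) - 1) / 2 - 1 / 2) / Real.pi = ((d : ℝ) - 2) / (2 * Real.pi) by ring,
    show ((d : ℝ) - 1) / 2 / Real.pi = ((d : ℝ) - 1) / (2 * Real.pi) by ring] at h
  exact h

lemma c2_sq_mem {d : ℕ} (hd : 3 ≤ d) :
    c2 d ^ 2 ∈ Set.Icc ((((d : ℝ) - 1) ^ 2 - 1) / (2 * Real.pi))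
      (((d : ℝ) - 1) ^ 2 / (2 * Real.pi)) := by
  have h3 : (3 : ℝ) ≤ d := by exact_mod_cast hd
  have h := Gamma_quotient_sq_mem
    (show 1 / 2 < ((d : ℝ) ^ 2 - 2 * (d : ℝ) + 1) / 2 by nlinarith)
  rw [show ((d : ℝ) ^ 2 - 2 * (d : ℝ) + 1) / 2 + 1 / 2 =
    ((d : ℝ) ^ 2 - 2 * (d : ℝ) + 2) / 2 by ring] at h
  rw [show (((d : ℝ) ^ 2 - 2 * (d : ℝ) + 1) / 2 - 1 / 2) / Real.pi =
      (((d : ℝ) - 1) ^ 2 - 1) / (2 * Real.pi) by ring,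
    show ((d : ℝ) ^ 2 - 2 * (d : ℝ) + 1) / 2 / Real.pi =
      ((d : ℝ) - 1) ^ 2 / (2 * Real.pi) by ring] at h
  exact h

lemma c2_pos {d : ℕ} (hd : 3 ≤ d) : 0 < c2 d := by
  have h3 : (3 : ℝ) ≤ d := by exact_mod_cast hd
  have g1 := Real.Gamma_pos_of_pos
    (show 0 < ((d : ℝ) ^ 2 - 2 * (d : ℝ) + 2) / 2 by nlinarith)
  have g2 := Real.Gamma_pos_of_pos
    (show 0 < ((d : ℝ) ^ 2 - 2 * (d : ℝ) + 1) / 2 by nlinarith)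
  have := Real.sqrt_pos.2 Real.pi_pos
  unfold c2
  positivity

lemma c1_le_c2 {d : ℕ} (hd : 3 ≤ d) : c1 d ≤ c2 d := by
  have h3 : (3 : ℝ) ≤ d := by exact_mod_cast hd
  refine (abs_le_of_sq_le_sq' ?_ (c2_pos hd).le).2
  refine (c1_sq_mem hd).2.trans (le_trans ?_ (c2_sq_mem hd).1)
  have := Real.pi_pos
  gcongr
  nlinarith

lemma c2_le_mul_c1 {d : ℕ} (hd : 3 ≤ d) : c2 d ≤ d * c1 d := by
  have h3 : (3 : ℝ) ≤ d := by exact_mod_cast hd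
  refine (abs_le_of_sq_le_sq' ?_ (mul_nonneg (by linarith) (c1_pos hd).le)).2
  have hpi := Real.pi_pos
  calc _ ≤ ((d : ℝ) - 1) ^ 2 / (2 * Real.pi) := (c2_sq_mem hd).2
    _ ≤ (d : ℝ) ^ 2 * (((d : ℝ) - 2) / (2 * Real.pi)) := by
        rw [mul_div_assoc']
        gcongr
        nlinarith
    _ ≤ _ := by
        rw [mul_pow]
        exact mul_le_mul_of_nonneg_left (c1_sq_mem hd).1 (by positivity)

lemma capScale_sq_mem {d : ℕ} (hd : 3 ≤ d) :
    capScale d ^ 2 ∈ Set.Icc (2 * Real.pi * ((d : ℝ) - 1))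
      (2 * Real.pi * (((d : ℝ) - 1) ^ 2 / ((d : ℝ) - 2))) := by
  have h3 : (3 : ℝ) ≤ d := by exact_mod_cast hd
  have hpi := Real.pi_pos
  have hc := c1_pos hd
  obtain ⟨h1, h2⟩ := c1_sq_mem hd
  rw [div_le_iff₀ (by positivity)] at h1
  rw [le_div_iff₀ (by positivity)] at h2
  rw [capScale, div_pow]
  constructor
  · rw [le_div_iff₀ (by positivity)]
    nlinarith
  · rw [mul_div_assoc', div_le_div_iff₀ (by positivity) (by linarith)]
    nlinarith [mul_le_mul_of_nonneg_left h1 (sq_nonneg ((d : ℝ) - 1))]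

lemma capScale_le {d : ℕ} (hd : 3 ≤ d) : capScale d ≤ 3 * d := by
  have h3 : (3 : ℝ) ≤ d := by exact_mod_cast hd
  refine (abs_le_of_sq_le_sq' ?_ (by positivity)).2
  refine (capScale_sq_mem hd).2.trans ?_
  rw [mul_div_assoc', div_le_iff₀ (by linarith)]
  have h4 : 2 * Real.pi * ((d : ℝ) - 1) ^ 2 ≤ 8 * ((d : ℝ) - 1) ^ 2 := by
    nlinarith [Real.pi_lt_four, sq_nonneg ((d : ℝ) - 1)]
  nlinarith [mul_nonneg (sq_nonneg (d : ℝ)) (show 0 ≤ (d : ℝ) - 3 by linarith)]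

lemma FF_eq {n d : ℕ} (hd : 3 ≤ d) :
    FF n d (-1) 1 = 2 * (c2 d / c1 d) * ((n.choose d : ℝ) * ∫ h in (-1 : ℝ)..1,
      (capRadial d h ^ (d - 2) * capCdf d h ^ (n - d)) * (c1 d * capWeight d h)) := by
  rw [FF, II_eq hd]
  ring

lemma le_FF {n d : ℕ} (hd : 3 ≤ d) (hn : d < n) (hnd : 2 * (d : ℝ) ^ 2 ≤ n) {a : ℝ}
    (ha : 0 ≤ a) (ha1 : a ≤ 1) (hG : (n : ℝ) ^ d * capCdf d a ^ (n - d) ≤ 1) :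
    n / (d : ℝ) ^ 2 * (a * capScale d) ^ (d - 2) ≤ FF n d (-1) 1 := by
  have h3 : (3 : ℝ) ≤ d := by exact_mod_cast hd
  have hA := (capScale_pos hd).le
  have hch : (n.choose d : ℝ) ≤ (n : ℝ) ^ d := by exact_mod_cast Nat.choose_le_pow n d
  have haI : a ∈ Set.Icc (-1 : ℝ) 1 := ⟨by linarith, ha1⟩
  have hG' : (n.choose d : ℝ) * capCdf d a ^ (n - d) ≤ 1 :=
    (mul_le_mul_of_nonneg_right hch (pow_nonneg (capCdf_nonneg hd haI) _)).trans hG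
  have h1 := mul_le_mul_of_nonneg_left (le_integral_capRadial hd (n - d) ha ha1)
    (Nat.cast_nonneg (α := ℝ) (n.choose d))
  rw [mul_left_comm, mul_sub, choose_mul_integral_tail hd hn] at h1
  have h2 : (n : ℝ) / (2 * (d : ℝ) ^ 2) ≤
      n / (d * ((d : ℝ) - 1)) - (n.choose d : ℝ) * capCdf d a ^ (n - d) := by
    have h5 : (n : ℝ) / (d : ℝ) ^ 2 ≤ n / (d * ((d : ℝ) - 1)) := by
      apply div_le_div_of_nonneg_left (by positivity) (by nlinarith) (by nlinarith)
    have h6 : 1 ≤ (n : ℝ) / (2 * (d : ℝ) ^ 2) := by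
      rw [le_div_iff₀ (by positivity)]
      linarith
    have h7 : (n : ℝ) / (d : ℝ) ^ 2 = 2 * (n / (2 * (d : ℝ) ^ 2)) := by
      field_simp
    linarith
  have h8 : 1 ≤ c2 d / c1 d := by
    rw [one_le_div (c1_pos hd)]
    exact c1_le_c2 hd
  rw [FF_eq hd]
  calc _ = 2 * 1 * ((a * capScale d) ^ (d - 2) * (n / (2 * (d : ℝ) ^ 2))) := by
        field_simp
    _ ≤ 2 * (c2 d / c1 d) * ((a * capScale d) ^ (d - 2) *
        (n / (d * ((d : ℝ) - 1)) - (n.choose d : ℝ) * capCdf d a ^ (n - d))) := by gcongr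
    _ ≤ _ := mul_le_mul_of_nonneg_left h1 (by linarith)

lemma FF_le {n d : ℕ} (hd : 3 ≤ d) (hn : d < n) {a b κ : ℝ} (ha : 0 ≤ a)
    (hab : a ≤ b) (hb : b ≤ 1) (hκ : 1 ≤ κ)
    (hle : ∀ h ∈ Set.Icc a b, capRadial d h ≤ κ * (1 - capCdf d h))
    (hG : (n : ℝ) ^ d * capCdf d a ^ (n - d) ≤ 1)
    (hU : (n : ℝ) ^ d * capRadial d b ^ (d - 2) ≤ 1) :
    FF n d (-1) 1 ≤ 6 * d * n * κ ^ (d - 2) := by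
  have h3 : (3 : ℝ) ≤ d := by exact_mod_cast hd
  have hch : (n.choose d : ℝ) ≤ (n : ℝ) ^ d := by exact_mod_cast Nat.choose_le_pow n d
  have hG' : (n.choose d : ℝ) * capCdf d a ^ (n - d) ≤ 1 :=
    (mul_le_mul_of_nonneg_right hch (pow_nonneg
      (capCdf_nonneg hd ⟨by linarith, by linarith⟩) _)).trans hG
  have hU' : (n.choose d : ℝ) * capRadial d b ^ (d - 2) ≤ 1 :=
    (mul_le_mul_of_nonneg_right hch (pow_nonneg
      (capRadial_nonneg d ⟨by linarith, by linarith⟩) _)).trans hU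
  have h1 := mul_le_mul_of_nonneg_left
    (integral_capRadial_le hd (n - d) ha hab hb (by linarith) hle)
    (Nat.cast_nonneg (α := ℝ) (n.choose d))
  rw [mul_add, mul_add, mul_left_comm (n.choose d : ℝ) (κ ^ (d - 2)),
    choose_mul_integral_tail hd hn] at h1
  have hκd : 1 ≤ κ ^ (d - 2) := one_le_pow₀ hκ
  have hn1 : (1 : ℝ) ≤ n := by exact_mod_cast (by omega : 1 ≤ n)
  have h2 : (n : ℝ) / (d * ((d : ℝ) - 1)) ≤ n := div_le_self (by linarith) (by nlinarith)
  have h8 : c2 d / c1 d ≤ d := by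
    rw [div_le_iff₀ (c1_pos hd)]
    exact c2_le_mul_c1 hd
  have h9 : (n.choose d : ℝ) * (∫ h in (-1 : ℝ)..1,
      (capRadial d h ^ (d - 2) * capCdf d h ^ (n - d)) * (c1 d * capWeight d h)) ≤
      3 * (n * κ ^ (d - 2)) := by
    have := mul_le_mul_of_nonneg_left h2 (zero_le_one.trans hκd)
    nlinarith [mul_le_mul hn1 hκd zero_le_one (by linarith)]
  have hq : 0 ≤ c2 d / c1 d := (div_pos (c2_pos hd) (c1_pos hd)).le
  rw [FF_eq hd]
  calc _ ≤ 2 * (c2 d / c1 d) * (3 * (n * κ ^ (d - 2))) :=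
        mul_le_mul_of_nonneg_left h9 (by linarith)
    _ ≤ 2 * (d : ℝ) * (3 * (n * κ ^ (d - 2))) := by gcongr
    _ = _ := by ring

section Asymptotics

variable {d : ℕ → ℕ} {ρ : ℝ}

lemma tendsto_dim_atTop (hρ : 0 < ρ)
    (hln : Tendsto (fun n : ℕ => Real.log n / (d n : ℝ)) atTop (nhds ρ)) :
    Tendsto (fun n => (d n : ℝ)) atTop atTop := by
  have hlog : Tendsto (fun n : ℕ => Real.log n) atTop atTop :=
    Real.tendsto_log_atTop.comp tendsto_natCast_atTop_atTop
  refine (hlog.atTop_mul_pos (inv_pos.2 hρ) (hln.inv₀ hρ.ne')).congr' ?_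
  filter_upwards [hlog.eventually_gt_atTop 0] with n hn
  rw [inv_div]
  field_simp

lemma eventually_exp_le (hln : Tendsto (fun n : ℕ => Real.log n / (d n : ℝ)) atTop (nhds ρ))
    (hx : Tendsto (fun n => (d n : ℝ)) atTop atTop) {τ : ℝ} (hτ : τ < ρ) :
    ∀ᶠ n in atTop, Real.exp (τ * d n) ≤ (n : ℝ) := by
  filter_upwards [hln.eventually_const_lt hτ, hx.eventually_gt_atTop 0,
    eventually_gt_atTop 0] with n h1 h2 h3
  rw [lt_div_iff₀ h2] at h1
  exact (Real.le_log_iff_exp_le (by exact_mod_cast h3)).1 h1.le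

lemma eventually_log_le (hln : Tendsto (fun n : ℕ => Real.log n / (d n : ℝ)) atTop (nhds ρ))
    (hx : Tendsto (fun n => (d n : ℝ)) atTop atTop) {τ : ℝ} (hτ : ρ < τ) :
    ∀ᶠ n : ℕ in atTop, Real.log n ≤ τ * d n := by
  filter_upwards [hln.eventually_lt_const hτ, hx.eventually_gt_atTop 0] with n h1 h2
  rw [div_lt_iff₀ h2] at h1
  exact h1.le

lemma eventually_mul_pow_le_exp {b : ℝ} (hb : 0 < b) {C : ℝ} (hC : 0 < C) (k : ℕ) :
    ∀ᶠ x : ℝ in atTop, C * x ^ k ≤ Real.exp (b * x) := by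
  filter_upwards [(isLittleO_pow_exp_pos_mul_atTop k hb).bound (inv_pos.2 hC)] with x hx
  rw [Real.norm_of_nonneg (Real.exp_pos _).le] at hx
  have h := (le_abs_self _).trans hx
  rwa [inv_mul_eq_div, le_div_iff₀ hC, mul_comm] at h

lemma eventually_mul_pow_dim_le (hρ : 0 < ρ)
    (hln : Tendsto (fun n : ℕ => Real.log n / (d n : ℝ)) atTop (nhds ρ)) {C : ℝ} (hC : 0 < C)
    (k : ℕ) : ∀ᶠ n : ℕ in atTop, C * (d n : ℝ) ^ k ≤ n := by
  have hx := tendsto_dim_atTop hρ hln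
  filter_upwards [eventually_exp_le hln hx (half_lt_self hρ),
    hx.eventually (eventually_mul_pow_le_exp (half_pos hρ) hC k)] with n h1 h2
  exact h2.trans h1

/-- Points at heights below the critical one do not contribute. -/
lemma eventually_pow_mul_capCdf_le_one (hρ : 0 < ρ)
    (hln : Tendsto (fun n : ℕ => Real.log n / (d n : ℝ)) atTop (nhds ρ))
    {a : ℝ} (ha : 0 ≤ a) (haρ : Real.exp (-2 * ρ) < 1 - a ^ 2) :
    ∀ᶠ n : ℕ in atTop, (n : ℝ) ^ d n * capCdf (d n) a ^ (n - d n) ≤ 1 := by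
  have hx := tendsto_dim_atTop hρ hln
  have h1a : 0 < 1 - a ^ 2 := (Real.exp_pos _).trans haρ
  have ha1 : a ≤ 1 := by nlinarith
  have haI : a ∈ Set.Icc (-1 : ℝ) 1 := ⟨by linarith, ha1⟩
  obtain ⟨σ, hσ⟩ : ∃ σ, σ = -Real.log (1 - a ^ 2) / 2 := ⟨_, rfl⟩
  have hσ0 : 0 ≤ σ := by
    have := Real.log_nonpos h1a.le (by nlinarith : 1 - a ^ 2 ≤ 1)
    linarith
  have hσρ : σ < ρ := by
    have := (Real.lt_log_iff_exp_lt h1a).2 haρ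
    linarith
  have hU : ∀ m : ℕ, Real.exp (-(σ * m)) ≤ capRadial m a := by
    intro m
    rw [capRadial, Real.rpow_def_of_pos h1a, Real.exp_le_exp]
    rw [show Real.log (1 - a ^ 2) = -(2 * σ) by rw [hσ]; ring]
    nlinarith
  filter_upwards [hx.eventually_ge_atTop 3, eventually_mul_pow_dim_le hρ hln two_pos 1,
    eventually_log_le hln hx (show ρ < 2 * ρ by linarith),
    eventually_exp_le hln hx (show (σ + ρ) / 2 < ρ by linarith),
    hx.eventually (eventually_mul_pow_le_exp (show 0 < (ρ - σ) / 2 by linarith)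
      (show 0 < 12 * ρ by linarith) 3), eventually_gt_atTop 0] with n h3 h2d hlog hexp hpoly hn0
  have hd : 3 ≤ d n := by exact_mod_cast h3
  have hn : (0 : ℝ) < n := by exact_mod_cast hn0
  rw [pow_one] at h2d
  have hA := capScale_pos hd
  have hN : (n : ℝ) / 2 ≤ ((n - d n : ℕ) : ℝ) := by
    rw [Nat.cast_sub (by exact_mod_cast (by linarith : (d n : ℝ) ≤ n))]
    linarith
  have hG0 := capCdf_nonneg hd haI
  have hGexp : capCdf (d n) a ≤ Real.exp (-(capRadial (d n) a / capScale (d n))) := by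
    have h1 := capRadial_le_tail hd haI
    have h2 : capRadial (d n) a / capScale (d n) ≤ 1 - capCdf (d n) a := by
      rw [div_le_iff₀ hA]
      linarith
    linarith [Real.add_one_le_exp (-(capRadial (d n) a / capScale (d n)))]
  have hkey : (d n : ℝ) * Real.log n ≤
      ((n - d n : ℕ) : ℝ) * (capRadial (d n) a / capScale (d n)) := by
    have h4 : 12 * ρ * (d n : ℝ) ^ 3 ≤ n * Real.exp (-(σ * d n)) := by
      refine hpoly.trans ?_
      refine le_trans ?_ (mul_le_mul_of_nonneg_right hexp (Real.exp_pos _).le)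
      rw [← Real.exp_add, Real.exp_le_exp]
      linarith
    calc (d n : ℝ) * Real.log n ≤ d n * (2 * ρ * d n) := by gcongr
      _ = (12 * ρ * (d n : ℝ) ^ 3) / 2 / (3 * d n) := by field_simp; ring
      _ ≤ (n * Real.exp (-(σ * d n))) / 2 / capScale (d n) := by
          gcongr
          exact capScale_le hd
      _ = n / 2 * (Real.exp (-(σ * d n)) / capScale (d n)) := by ring
      _ ≤ _ := by
          gcongr
          exact hU _
  calc _ ≤ Real.exp (d n * Real.log n) *
        Real.exp (-(capRadial (d n) a / capScale (d n))) ^ (n - d n) := by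
        rw [Real.exp_nat_mul, Real.exp_log hn]
        gcongr
    _ ≤ 1 := by
        rw [← Real.exp_nat_mul, ← Real.exp_add, Real.exp_le_one_iff]
        linarith

lemma tendsto_inv_dim_sub_one (hx : Tendsto (fun n => (d n : ℝ)) atTop atTop) :
    Tendsto (fun n => ((d n : ℝ) - 1)⁻¹) atTop (nhds 0) :=
  (tendsto_atTop_add_const_right _ (-1) hx).inv_tendsto_atTop

/-- Points at heights above the critical one do not contribute. -/
lemma eventually_pow_mul_capRadial_le_one
    (hln : Tendsto (fun n : ℕ => Real.log n / (d n : ℝ)) atTop (nhds ρ))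
    (hx : Tendsto (fun n => (d n : ℝ)) atTop atTop)
    {b : ℝ} (hb : 0 < 1 - b ^ 2) (hbρ : 1 - b ^ 2 < Real.exp (-2 * ρ)) :
    ∀ᶠ n : ℕ in atTop, (n : ℝ) ^ d n * capRadial (d n) b ^ (d n - 2) ≤ 1 := by
  have hlogb : Real.log (1 - b ^ 2) < -2 * ρ := (Real.log_lt_iff_lt_exp hb).2 hbρ
  have hinv : Tendsto (fun n => ((d n : ℝ))⁻¹) atTop (nhds 0) := hx.inv_tendsto_atTop
  have hlim : Tendsto (fun n : ℕ => Real.log n / d n +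
      (1 - 2 * (d n : ℝ)⁻¹) * (1 - (d n : ℝ)⁻¹) * (Real.log (1 - b ^ 2) / 2)) atTop
      (nhds (ρ + (1 - 2 * 0) * (1 - 0) * (Real.log (1 - b ^ 2) / 2))) :=
    hln.add ((((hinv.const_mul 2).const_sub 1).mul (hinv.const_sub 1)).mul_const _)
  filter_upwards [hx.eventually_ge_atTop 3, hlim.eventually_lt_const
    (show ρ + (1 - 2 * 0) * (1 - 0) * (Real.log (1 - b ^ 2) / 2) < 0 by linarith), eventually_gt_atTop 0] with n h3 hneg hn0
  have hd : 3 ≤ d n := by exact_mod_cast h3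
  have hn : (0 : ℝ) < n := by exact_mod_cast hn0
  have hd0 : (0 : ℝ) < d n := by linarith
  have hcast : ((d n - 2 : ℕ) : ℝ) = d n - 2 := by
    rw [Nat.cast_sub (by omega)]
    norm_num
  calc _ = Real.exp (d n * Real.log n + ((d n - 2 : ℕ) : ℝ) *
        (Real.log (1 - b ^ 2) * (((d n : ℝ) - 1) / 2))) := by
        rw [Real.exp_add, Real.exp_nat_mul, Real.exp_nat_mul, Real.exp_log hn, capRadial,
          Real.rpow_def_of_pos hb]
    _ ≤ 1 := by
        rw [Real.exp_le_one_iff, hcast]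
        have h5 : (d n : ℝ) * Real.log n + ((d n : ℝ) - 2) *
            (Real.log (1 - b ^ 2) * (((d n : ℝ) - 1) / 2)) = (d n : ℝ) ^ 2 *
            (Real.log n / d n + (1 - 2 * (d n : ℝ)⁻¹) * (1 - (d n : ℝ)⁻¹) *
              (Real.log (1 - b ^ 2) / 2)) := by
          field_simp
        rw [h5]
        exact mul_nonpos_of_nonneg_of_nonpos (by positivity) hneg.le

lemma tendsto_log_capScale (hx : Tendsto (fun n => (d n : ℝ)) atTop atTop) :
    Tendsto (fun n => 2 * Real.log (capScale (d n)) - Real.log (d n)) atTop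
      (nhds (Real.log (2 * Real.pi))) := by
  have hpi := Real.pi_pos
  have hinv : Tendsto (fun n => ((d n : ℝ))⁻¹) atTop (nhds 0) := hx.inv_tendsto_atTop
  have hsq : Tendsto (fun n => capScale (d n) ^ 2 / d n) atTop (nhds (2 * Real.pi)) := by
    have hlow : Tendsto (fun n => 2 * Real.pi * (1 - (d n : ℝ)⁻¹)) atTop
        (nhds (2 * Real.pi)) := by
      simpa using (hinv.const_sub 1).const_mul (2 * Real.pi)
    have hup : Tendsto (fun n => 2 * Real.pi * ((1 - (d n : ℝ)⁻¹) ^ 2 /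
        (1 - 2 * (d n : ℝ)⁻¹))) atTop (nhds (2 * Real.pi)) := by
      have := (((hinv.const_sub 1).pow 2).div ((hinv.const_mul 2).const_sub 1)
        (by norm_num)).const_mul (2 * Real.pi)
      simpa using this
    refine tendsto_of_tendsto_of_tendsto_of_le_of_le' hlow hup ?_ ?_
    all_goals
      filter_upwards [hx.eventually_ge_atTop 3] with n h3
      have hd : 3 ≤ d n := by exact_mod_cast h3
      have hd0 : (0 : ℝ) < d n := by linarith
      have hd2 : (0 : ℝ) < (d n : ℝ) - 2 := by linarith
    · rw [le_div_iff₀ hd0]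
      refine le_trans (le_of_eq ?_) (capScale_sq_mem hd).1
      field_simp
    · rw [div_le_iff₀ hd0]
      refine (capScale_sq_mem hd).2.trans (le_of_eq ?_)
      field_simp
  refine (hsq.log (by positivity)).congr' ?_
  filter_upwards [hx.eventually_ge_atTop 3] with n h3
  have hd : 3 ≤ d n := by exact_mod_cast h3
  have hA := capScale_pos hd
  rw [Real.log_div (by positivity) (by linarith), Real.log_pow]
  norm_num

lemma tendsto_normalized_log
    (hln : Tendsto (fun n : ℕ => Real.log n / (d n : ℝ)) atTop (nhds ρ))
    (hx : Tendsto (fun n => (d n : ℝ)) atTop atTop) (c e : ℝ) {κ : ℝ} (hκ : 0 < κ) :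
    Tendsto (fun n : ℕ => (c + e * Real.log (d n) + Real.log n +
      ((d n : ℝ) - 2) * Real.log (κ * capScale (d n))) * (2 / ((d n : ℝ) - 1)) -
      Real.log (d n)) atTop (nhds (2 * ρ + Real.log (2 * Real.pi) + 2 * Real.log κ)) := by
  have hinv := tendsto_inv_dim_sub_one hx
  have hlogd : Tendsto (fun n => Real.log (d n) * ((d n : ℝ) - 1)⁻¹) atTop (nhds 0) := by
    have h1 : Tendsto (fun n => Real.log (d n) / (d n : ℝ)) atTop (nhds 0) :=
      (Real.isLittleO_log_id_atTop.tendsto_div_nhds_zero).comp hx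
    have h2 := h1.mul (hinv.const_add 1)
    rw [zero_mul] at h2
    refine h2.congr' ?_
    filter_upwards [hx.eventually_ge_atTop 3] with n h3
    have : (0 : ℝ) < (d n : ℝ) - 1 := by linarith
    have : (0 : ℝ) < (d n : ℝ) := by linarith
    field_simp
    ring
  have hlim := ((((hinv.const_mul (2 * c)).add (hlogd.const_mul (2 * e))).add
    ((hln.mul (hinv.const_add 1)).const_mul 2)).add
    ((hinv.const_sub 1).mul ((tendsto_log_capScale hx).add_const (2 * Real.log κ)))).sub hlogd
  have hval : 2 * c * 0 + 2 * e * 0 + 2 * (ρ * (1 + 0)) +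
      (1 - 0) * (Real.log (2 * Real.pi) + 2 * Real.log κ) - 0 =
      2 * ρ + Real.log (2 * Real.pi) + 2 * Real.log κ := by ring
  rw [hval] at hlim
  refine hlim.congr' ?_
  filter_upwards [hx.eventually_ge_atTop 3] with n h3
  have h1 : (0 : ℝ) < (d n : ℝ) - 1 := by linarith
  have h0 : (0 : ℝ) < (d n : ℝ) := by linarith
  have hA := capScale_pos (show 3 ≤ d n by exact_mod_cast h3)
  rw [Real.log_mul hκ.ne' hA.ne']
  field_simp
  ring

lemma eventually_le_log_FF (hρ : 0 < ρ)
    (hln : Tendsto (fun n : ℕ => Real.log n / (d n : ℝ)) atTop (nhds ρ))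
    {κ : ℝ} (hκ : 0 < κ) (hκρ : Real.exp (-2 * ρ) < 1 - κ ^ 2) :
    ∀ᶠ n : ℕ in atTop, 0 < FF n (d n) (-1) 1 ∧
      0 + (-2) * Real.log (d n) + Real.log n +
        ((d n : ℝ) - 2) * Real.log (κ * capScale (d n)) ≤ Real.log (FF n (d n) (-1) 1) := by
  have hx := tendsto_dim_atTop hρ hln
  have hκ1 : κ ≤ 1 := by nlinarith [Real.exp_pos (-2 * ρ)]
  filter_upwards [hx.eventually_ge_atTop 3, eventually_mul_pow_dim_le hρ hln two_pos 1,
    eventually_mul_pow_dim_le hρ hln two_pos 2,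
    eventually_pow_mul_capCdf_le_one hρ hln hκ.le hκρ, eventually_gt_atTop 0]
    with n h3 h2d h2d2 hG hn0
  have hd : 3 ≤ d n := by exact_mod_cast h3
  have hn : (0 : ℝ) < n := by exact_mod_cast hn0
  have hd0 : (0 : ℝ) < d n := by linarith
  have hA := capScale_pos hd
  have hF := le_FF hd (by exact_mod_cast (by linarith : (d n : ℝ) < n)) h2d2 hκ.le hκ1 hG
  have hpos : 0 < (n : ℝ) / (d n : ℝ) ^ 2 * (κ * capScale (d n)) ^ (d n - 2) := by positivity
  refine ⟨hpos.trans_le hF, le_trans (le_of_eq ?_) (Real.log_le_log hpos hF)⟩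
  rw [Real.log_mul (x := n / (d n : ℝ) ^ 2) (by positivity) (by positivity),
    Real.log_div hn.ne' (by positivity),
    Real.log_pow, Real.log_pow, Nat.cast_sub (by omega)]
  push_cast
  ring

lemma eventually_log_FF_le (hρ : 0 < ρ)
    (hln : Tendsto (fun n : ℕ => Real.log n / (d n : ℝ)) atTop (nhds ρ))
    {κ : ℝ} (hκ : 0 < κ) (hκ1 : κ < 1) (hκρ : 1 - κ ^ 2 < Real.exp (-2 * ρ)) :
    ∀ᶠ n : ℕ in atTop, 0 < FF n (d n) (-1) 1 → Real.log (FF n (d n) (-1) 1) ≤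
      Real.log 6 + 1 * Real.log (d n) + Real.log n +
        ((d n : ℝ) - 2) * Real.log (κ * capScale (d n)) := by
  have hx := tendsto_dim_atTop hρ hln
  have hexp1 : Real.exp (-2 * ρ) < 1 := Real.exp_lt_one_iff.2 (by linarith)
  obtain ⟨b, hb0, hbκ, hbρ⟩ : ∃ b, 0 < b ∧ b < κ ∧ 1 - b ^ 2 < Real.exp (-2 * ρ) := by
    have hc : ContinuousAt (fun b : ℝ => 1 - b ^ 2) κ := by fun_prop
    have h1 : ∀ᶠ b in nhdsWithin κ (Set.Iio κ), 1 - b ^ 2 < Real.exp (-2 * ρ) :=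
      (hc.eventually_lt_const hκρ).filter_mono nhdsWithin_le_nhds
    have h2 : ∀ᶠ b in nhdsWithin κ (Set.Iio κ), 0 < b :=
      (lt_mem_nhds hκ).filter_mono nhdsWithin_le_nhds
    obtain ⟨b, h⟩ := (h1.and (h2.and self_mem_nhdsWithin)).exists
    exact ⟨b, h.2.1, h.2.2, h.1⟩
  obtain ⟨ε, hε⟩ : ∃ ε, ε = (κ - b) / 2 := ⟨_, rfl⟩
  have hε0 : 0 < ε := by linarith
  have hε1 : ε < 1 := by linarith
  have hq : Tendsto (fun n => κ * (1 - (1 - ε ^ 2) ^ (((d n : ℝ) - 1) / 2))) atTop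
      (nhds κ) := by
    have h1 : Tendsto (fun n => ((d n : ℝ) - 1) / 2) atTop atTop :=
      (tendsto_atTop_add_const_right _ (-1) hx).atTop_div_const two_pos
    have h2 := (tendsto_rpow_atTop_of_base_lt_one (1 - ε ^ 2) (by nlinarith)
      (by nlinarith)).comp h1
    simpa using (h2.const_sub 1).const_mul κ
  filter_upwards [hx.eventually_ge_atTop 3, eventually_mul_pow_dim_le hρ hln two_pos 1,
    eventually_pow_mul_capCdf_le_one hρ hln le_rfl (show Real.exp (-2 * ρ) < 1 - 0 ^ 2 by simpa),
    eventually_pow_mul_capRadial_le_one hln hx (show 0 < 1 - b ^ 2 by nlinarith) hbρ,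
    hq.eventually_const_lt (show b + ε < κ by linarith), eventually_gt_atTop 0,
    hx.eventually_ge_atTop (1 + (κ ^ 2)⁻¹)]
    with n h3 h2d hG hU hqn hn0 hlarge hFpos
  have hd : 3 ≤ d n := by exact_mod_cast h3
  have hn : (0 : ℝ) < n := by exact_mod_cast hn0
  have hd0 : (0 : ℝ) < d n := by linarith
  have hA := capScale_pos hd
  have hK : 1 ≤ κ * capScale (d n) := by
    refine (abs_le_of_sq_le_sq' ?_ (by positivity)).2
    have h1 := mul_le_mul_of_nonneg_left (capScale_sq_mem hd).1 (sq_nonneg κ)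
    have h2 : κ ^ 2 * (κ ^ 2)⁻¹ ≤ κ ^ 2 * ((d n : ℝ) - 1) := by
      gcongr
      linarith
    rw [mul_inv_cancel₀ (by positivity)] at h2
    nlinarith [Real.pi_gt_three]
  have hF := FF_le hd (by exact_mod_cast (by linarith : (d n : ℝ) < n)) le_rfl hb0.le
    (by linarith) hK (fun h hh => ?_) hG hU
  · refine (Real.log_le_log hFpos hF).trans (le_of_eq ?_)
    rw [Real.log_mul (by positivity) (by positivity), Real.log_mul (by positivity) hn.ne',
      Real.log_mul (by positivity) (by positivity), Real.log_pow, Nat.cast_sub (by omega)]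
    push_cast
    ring
  · have hT : 0 ≤ capScale (d n) * (1 - capCdf (d n) h) := mul_nonneg hA.le
      (by linarith [capCdf_le_one hd (show h ∈ Set.Icc (-1 : ℝ) 1 from
        ⟨by linarith [hh.1], by linarith [hh.2]⟩)])
    have h1 := capRadial_mul_le_tail hd hh.1 hε0.le (by linarith [hh.2])
    have hpos : 0 < 1 - (1 - ε ^ 2) ^ (((d n : ℝ) - 1) / 2) := by
      by_contra hcon
      nlinarith [mul_nonneg hκ.le (by linarith [not_lt.1 hcon] :
        0 ≤ -(1 - (1 - ε ^ 2) ^ (((d n : ℝ) - 1) / 2)))]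
    refine le_of_mul_le_mul_right (h1.trans ?_) hpos
    calc _ ≤ κ * (1 - (1 - ε ^ 2) ^ (((d n : ℝ) - 1) / 2)) *
          (capScale (d n) * (1 - capCdf (d n) h)) :=
          mul_le_mul_of_nonneg_right (by linarith [hh.2]) hT
      _ = _ := by ring

lemma tendsto_log_FF (hρ : 0 < ρ)
    (hln : Tendsto (fun n : ℕ => Real.log n / (d n : ℝ)) atTop (nhds ρ)) :
    Tendsto (fun n : ℕ => Real.log (FF n (d n) (-1) 1) * (2 / ((d n : ℝ) - 1)) -
      Real.log (d n)) atTop (nhds (Real.log (2 * Real.pi * (Real.exp (2 * ρ) - 1)))) := by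
  have hx := tendsto_dim_atTop hρ hln
  have hexp1 : Real.exp (-2 * ρ) < 1 := Real.exp_lt_one_iff.2 (by linarith)
  obtain ⟨κ₀, hκ₀⟩ : ∃ κ₀, κ₀ = Real.sqrt (1 - Real.exp (-2 * ρ)) := ⟨_, rfl⟩
  have hκ₀sq : κ₀ ^ 2 = 1 - Real.exp (-2 * ρ) := by rw [hκ₀, Real.sq_sqrt (by linarith)]
  have hκ₀pos : 0 < κ₀ := hκ₀ ▸ Real.sqrt_pos.2 (by linarith)
  have hκ₀1 : κ₀ < 1 := by nlinarith [Real.exp_pos (-2 * ρ)]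
  have hL : Real.log (2 * Real.pi * (Real.exp (2 * ρ) - 1)) =
      2 * ρ + Real.log (2 * Real.pi) + 2 * Real.log κ₀ := by
    have h1 : Real.exp (2 * ρ) - 1 = Real.exp (2 * ρ) * κ₀ ^ 2 := by
      rw [hκ₀sq, mul_sub, ← Real.exp_add]
      norm_num
    have hpi := Real.pi_pos
    rw [h1, Real.log_mul (by positivity) (by positivity),
      Real.log_mul (Real.exp_pos _).ne' (by positivity), Real.log_exp, Real.log_pow]
    push_cast
    ring
  have hcont : ContinuousAt
      (fun κ => 2 * ρ + Real.log (2 * Real.pi) + 2 * Real.log κ) κ₀ :=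
    ((Real.continuousAt_log hκ₀pos.ne').const_mul 2).const_add _
  rw [hL, tendsto_order]
  constructor
  · intro y hy
    have h1 : ∀ᶠ κ in nhdsWithin κ₀ (Set.Iio κ₀),
        y < 2 * ρ + Real.log (2 * Real.pi) + 2 * Real.log κ :=
      (hcont.eventually_const_lt hy).filter_mono nhdsWithin_le_nhds
    have h2 : ∀ᶠ κ in nhdsWithin κ₀ (Set.Iio κ₀), 0 < κ :=
      (lt_mem_nhds hκ₀pos).filter_mono nhdsWithin_le_nhds
    obtain ⟨κ, hκy, hκ, hκlt⟩ := (h1.and (h2.and self_mem_nhdsWithin)).exists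
    have hκlt' : κ < κ₀ := hκlt
    filter_upwards [eventually_le_log_FF hρ hln hκ (by nlinarith),
      (tendsto_normalized_log hln hx 0 (-2) hκ).eventually_const_lt hκy,
      hx.eventually_ge_atTop 3] with n hF hy' h3
    have h4 : 0 < 2 / ((d n : ℝ) - 1) := div_pos two_pos (by linarith)
    linarith [mul_le_mul_of_nonneg_right hF.2 h4.le]
  · intro y hy
    have h1 : ∀ᶠ κ in nhdsWithin κ₀ (Set.Ioi κ₀),
        2 * ρ + Real.log (2 * Real.pi) + 2 * Real.log κ < y :=
      (hcont.eventually_lt_const hy).filter_mono nhdsWithin_le_nhds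
    have h2 : ∀ᶠ κ in nhdsWithin κ₀ (Set.Ioi κ₀), κ < 1 :=
      (gt_mem_nhds hκ₀1).filter_mono nhdsWithin_le_nhds
    obtain ⟨κ, hκy, hκ1, hκgt⟩ := (h1.and (h2.and self_mem_nhdsWithin)).exists
    have hκgt' : κ₀ < κ := hκgt
    have hκ : 0 < κ := hκ₀pos.trans hκgt'
    have hhalf : 0 < κ₀ / 2 := half_pos hκ₀pos
    filter_upwards [eventually_le_log_FF hρ hln hhalf (by nlinarith),
      eventually_log_FF_le hρ hln hκ hκ1 (by nlinarith),
      (tendsto_normalized_log hln hx (Real.log 6) 1 hκ).eventually_lt_const hκy,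
      hx.eventually_ge_atTop 3] with n hpos hF hy' h3
    have h4 : 0 < 2 / ((d n : ℝ) - 1) := div_pos two_pos (by linarith)
    linarith [mul_le_mul_of_nonneg_right (hF hpos.1) h4.le]

end Asymptotics

/-- in the exponential regime `(ln n)/d → ρ ∈ (0,∞)`, the expected number
of facets satisfies `F = [2π(e^{2ρ}-1)·d·(1+o(1))]^{(d-1)/2}`. -/
theorem facet_count_exponential (d : ℕ → ℕ) (ρ : ℝ) (hρ : 0 < ρ)
    (hd : ∀ᶠ n in atTop, 2 ≤ d n ∧ d n < n)
    (hln : Tendsto (fun n : ℕ => Real.log n / (d n : ℝ)) atTop (nhds ρ)) :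
    Tendsto (fun n : ℕ =>
        (FF n (d n) (-1) 1) ^ (2 / ((d n : ℝ) - 1)) / (d n : ℝ))
      atTop (nhds (2 * Real.pi * (Real.exp (2 * ρ) - 1))) := by
  have hx := tendsto_dim_atTop hρ hln
  have hexp : 1 < Real.exp (2 * ρ) := Real.one_lt_exp_iff.2 (by linarith)
  have hL : 0 < 2 * Real.pi * (Real.exp (2 * ρ) - 1) :=
    mul_pos (by positivity) (by linarith)
  have hκ : 0 < Real.sqrt ((1 - Real.exp (-2 * ρ)) / 2) :=
    Real.sqrt_pos.2 (by linarith [Real.exp_lt_one_iff.2 (show -2 * ρ < 0 by linarith)])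
  have hκρ : Real.exp (-2 * ρ) < 1 - Real.sqrt ((1 - Real.exp (-2 * ρ)) / 2) ^ 2 := by
    have h := Real.exp_lt_one_iff.2 (show -2 * ρ < 0 by linarith)
    rw [Real.sq_sqrt (by linarith)]
    linarith
  have hlim := (Real.continuous_exp.tendsto _).comp (tendsto_log_FF hρ hln)
  rw [Real.exp_log hL] at hlim
  refine hlim.congr' ?_
  filter_upwards [eventually_le_log_FF hρ hln hκ hκρ, hx.eventually_gt_atTop 0] with n hF hd0
  rw [Function.comp_apply, Real.exp_sub, Real.exp_log hd0, Real.rpow_def_of_pos hF.1]
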